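/- Let T_α = α·Iₙ + ((1−α)/n)·Eₙ be the n×n Hamming channel with α ∈ [0,1], let C ∈ [0, log n], and let β = gₙ⁻¹(C). Then R_{T_α}(uₙ, C) := log n − min{ H(T_α v) : v ∈ Δₙ, H(v) ≥ log n − C } satisfies R_{T_α}(uₙ, C) = gₙ(αβ) = ((1 + (n−1)αβ)/n)·log(1 + (n−1)αβ) + ((n−1)(1−αβ)/n)·log(1−αβ), and the minimum is attained by v = β·e + (1−β)·uₙ for any standard basis vector e (i.e., R_{T_α}(uₙ,C) is attained with a Hamming test channel with parameter β). -/

import Mathlib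

open Matrix BigOperators

noncomputable section

/-- A probability vector: nonnegative entries summing to 1. -/
def probVec {n : ℕ} (p : Fin n → ℝ) : Prop := (∀ i, 0 ≤ p i) ∧ ∑ i, p i = 1

/-- Shannon entropy (`Real.log 0 = 0` gives the convention `0 · log 0 = 0`). -/
def ent {n : ℕ} (p : Fin n → ℝ) : ℝ := -∑ i, p i * Real.log (p i)

/-- The `n × n` Hamming channel `T_α = α·Iₙ + ((1−α)/n)·Eₙ`. -/
def hammingT (n : ℕ) (α : ℝ) : Matrix (Fin n) (Fin n) ℝ :=
  α • (1 : Matrix (Fin n) (Fin n) ℝ) + ((1 - α) / n) • Matrix.of (fun _ _ => (1 : ℝ))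

/-- `gₙ(β) = ((n−1)/n)(1−β)log(1−β) + ((βn+1−β)/n)log(βn+1−β)`. -/
def gfun (n : ℕ) (β : ℝ) : ℝ :=
  ((n - 1 : ℝ) / n) * (1 - β) * Real.log (1 - β) +
    ((β * n + 1 - β) / n) * Real.log (β * n + 1 - β)

/-- `s ↦ α log (α eˢ + c)` is convex for nonnegative `α`, `c`. -/
lemma convexOn_mul_log_mul_exp_add {α c : ℝ} (hα : 0 ≤ α) (hc : 0 ≤ c) (hαc : 0 < α + c) :
    ConvexOn ℝ Set.univ fun s : ℝ => α * Real.log (α * Real.exp s + c) := by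
  have hpos : ∀ s : ℝ, 0 < α * Real.exp s + c := by
    intro s
    have := Real.exp_pos s
    rcases hα.eq_or_lt with h | h
    · subst h; linarith
    · positivity
  have hder : ∀ s : ℝ, HasDerivAt (fun s : ℝ => α * Real.log (α * Real.exp s + c))
      (α * (α * Real.exp s / (α * Real.exp s + c))) s := fun s =>
    ((((Real.hasDerivAt_exp s).const_mul α).add_const c).log (hpos s).ne').const_mul α
  refine Monotone.convexOn_univ_of_deriv (fun s => (hder s).differentiableAt) ?_
  intro s t hst
  rw [(hder s).deriv, (hder t).deriv]
  refine mul_le_mul_of_nonneg_left ?_ hα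
  rw [div_le_div_iff₀ (hpos s) (hpos t)]
  have h1 : α * c * Real.exp s ≤ α * c * Real.exp t :=
    mul_le_mul_of_nonneg_left (Real.exp_le_exp.2 hst) (mul_nonneg hα hc)
  nlinarith

/-- A convex function lies below its chord over `[x, y]` and above it outside `[x, y]`. -/
lemma ConvexOn.chord_sign {h : ℝ → ℝ} (hh : ConvexOn ℝ Set.univ h) {x y : ℝ} (hxy : x < y)
    (t : ℝ) :
    (t ≤ x → h x + (h y - h x) / (y - x) * (t - x) ≤ h t) ∧
    (x ≤ t → t ≤ y → h t ≤ h x + (h y - h x) / (y - x) * (t - x)) ∧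
    (y ≤ t → h x + (h y - h x) / (y - x) * (t - x) ≤ h t) := by
  have hd : 0 < y - x := sub_pos.2 hxy
  refine ⟨fun ht => ?_, fun h1 h2 => ?_, fun ht => ?_⟩
  · rcases ht.eq_or_lt with rfl | ht
    · simp
    have := hh.secant_mono (Set.mem_univ x) (Set.mem_univ t) (Set.mem_univ y) ht.ne hxy.ne'
      (ht.trans hxy).le
    rw [div_le_iff_of_neg (sub_neg.2 ht)] at this
    linarith
  · rcases h1.eq_or_lt with rfl | h1
    · simp
    have := hh.secant_mono (Set.mem_univ x) (Set.mem_univ t) (Set.mem_univ y) h1.ne' hxy.ne' h2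
    rw [div_le_iff₀ (sub_pos.2 h1)] at this
    linarith
  · have hxt := hxy.trans_le ht
    have := hh.secant_mono (Set.mem_univ x) (Set.mem_univ y) (Set.mem_univ t) hxy.ne' hxt.ne' ht
    rw [le_div_iff₀ (sub_pos.2 hxt)] at this
    linarith

/-- Multipliers for which the Lagrangian `φ t - l t log t - m t`, where
`φ t = (α t + c) log (α t + c)`, is maximal over `[0, M]` at `b` and is smaller at `M` than at
any later point. -/
lemma exists_multipliers {α c b M a : ℝ} (hα : 0 ≤ α) (hc : 0 ≤ c) (hαc : 0 < α + c)
    (hb : 0 < b) (hbM : b < M) (hMa : M ≤ a) :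
    ∃ l m : ℝ, 0 ≤ l ∧
      (∀ t, 0 ≤ t → t ≤ M →
        (α * t + c) * Real.log (α * t + c) - l * (t * Real.log t) - m * t ≤
          (α * b + c) * Real.log (α * b + c) - l * (b * Real.log b) - m * b) ∧
      (α * M + c) * Real.log (α * M + c) - l * (M * Real.log M) - m * M ≤
          (α * a + c) * Real.log (α * a + c) - l * (a * Real.log a) - m * a := by
  have hpos : ∀ t : ℝ, 0 < t → 0 < α * t + c := by
    intro t ht
    rcases hα.eq_or_lt with h | h
    · subst h; linarith
    · positivity
  have hM : 0 < M := hb.trans hbM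
  set h : ℝ → ℝ := fun s => α * Real.log (α * Real.exp s + c) with hh
  have hlog : ∀ t : ℝ, 0 < t → h (Real.log t) = α * Real.log (α * t + c) := by
    intro t ht; simp only [hh, Real.exp_log ht]
  have hlt : Real.log b < Real.log M := Real.log_lt_log hb hbM
  set l := (h (Real.log M) - h (Real.log b)) / (Real.log M - Real.log b) with hl
  set m := h (Real.log b) - l * Real.log b + α - l with hm
  have hchord := (convexOn_mul_log_mul_exp_add hα hc hαc).chord_sign hlt
  set ψ : ℝ → ℝ := fun t =>
    (α * t + c) * Real.log (α * t + c) - l * (t * Real.log t) - m * t with hψ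
  have hcont : Continuous ψ := by
    have h1 : Continuous fun t : ℝ => (α * t + c) * Real.log (α * t + c) :=
      Real.continuous_mul_log.comp (by fun_prop : Continuous fun t : ℝ => α * t + c)
    have h2 := Real.continuous_mul_log
    exact (h1.sub (h2.const_mul l)).sub (by fun_prop)
  have hder : ∀ t : ℝ, 0 < t → HasDerivAt ψ
      (h (Real.log t) - (h (Real.log b) + l * (Real.log t - Real.log b))) t := by
    intro t ht
    have h0 : HasDerivAt (fun t : ℝ => α * t + c) α t := by
      simpa using ((hasDerivAt_id t).const_mul α).add_const c
    have h1 := (Real.hasDerivAt_mul_log (hpos t ht).ne').comp t h0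
    have h2 := (Real.hasDerivAt_mul_log ht.ne').const_mul l
    have h3 := (hasDerivAt_id t).const_mul m
    have h4 := (h1.sub h2).sub h3
    refine HasDerivAt.congr_deriv (f := ψ) h4 ?_
    rw [hlog t ht, hm]
    ring
  have hmono₁ : MonotoneOn ψ (Set.Icc 0 b) := by
    refine monotoneOn_of_deriv_nonneg (convex_Icc 0 b) hcont.continuousOn ?_ ?_ <;>
      rw [interior_Icc]
    · exact fun t ht => (hder t ht.1).differentiableAt.differentiableWithinAt
    · intro t ht
      rw [(hder t ht.1).deriv]
      exact sub_nonneg.2 ((hchord _).1 (Real.log_le_log ht.1 ht.2.le))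
  have hanti : AntitoneOn ψ (Set.Icc b M) := by
    refine antitoneOn_of_deriv_nonpos (convex_Icc b M) hcont.continuousOn ?_ ?_ <;>
      rw [interior_Icc]
    · exact fun t ht => (hder t (hb.trans ht.1)).differentiableAt.differentiableWithinAt
    · intro t ht
      have ht0 := hb.trans ht.1
      rw [(hder t ht0).deriv]
      exact sub_nonpos.2 ((hchord _).2.1 (Real.log_le_log hb ht.1.le)
        (Real.log_le_log ht0 ht.2.le))
  have hmono₂ : MonotoneOn ψ (Set.Icc M a) := by
    refine monotoneOn_of_deriv_nonneg (convex_Icc M a) hcont.continuousOn ?_ ?_ <;>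
      rw [interior_Icc]
    · exact fun t ht => (hder t (hM.trans ht.1)).differentiableAt.differentiableWithinAt
    · intro t ht
      rw [(hder t (hM.trans ht.1)).deriv]
      exact sub_nonneg.2 ((hchord _).2.2 (Real.log_le_log hM ht.1.le))
  refine ⟨l, m, ?_, fun t ht0 htM => ?_, ?_⟩
  · refine div_nonneg ?_ (sub_pos.2 hlt).le
    rw [hlog b hb, hlog M hM]
    refine sub_nonneg.2 (mul_le_mul_of_nonneg_left ?_ hα)
    exact Real.log_le_log (hpos b hb)
      (add_le_add_left (mul_le_mul_of_nonneg_left hbM.le hα) c)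
  · rcases le_total t b with htb | htb
    · exact hmono₁ ⟨ht0, htb⟩ ⟨hb.le, le_rfl⟩ htb
    · exact hanti ⟨le_rfl, hbM.le⟩ ⟨htb, htM⟩ htb
  · exact hmono₂ ⟨le_rfl, hMa⟩ ⟨hMa, le_rfl⟩ hMa

/-- `t log t` minus its tangent line at `b` is strictly increasing on `[b, ∞)`. -/
lemma mul_log_sub_strictMonoOn {b : ℝ} (hb : 0 < b) :
    StrictMonoOn (fun t : ℝ => t * Real.log t - (Real.log b + 1) * t) (Set.Ici b) := by
  refine strictMonoOn_of_deriv_pos (convex_Ici b)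
    (Real.continuous_mul_log.sub (by fun_prop)).continuousOn ?_
  rw [interior_Ici]
  intro t ht
  have h := (Real.hasDerivAt_mul_log (hb.trans ht).ne').sub
    ((hasDerivAt_id t).const_mul (Real.log b + 1))
  have h' : HasDerivAt (fun t : ℝ => t * Real.log t - (Real.log b + 1) * t) _ t := h
  rw [h'.deriv]
  have := Real.log_lt_log hb ht
  linarith

/-- `t log t` lies above its tangent line at `b`. -/
lemma mul_log_tangent {b t : ℝ} (hb : 0 < b) (ht : 0 ≤ t) :
    b * Real.log b - (Real.log b + 1) * b ≤ t * Real.log t - (Real.log b + 1) * t := by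
  rcases ht.eq_or_lt with rfl | ht
  · simp; nlinarith
  have h := Real.log_le_sub_one_of_pos (div_pos hb ht)
  rw [Real.log_div hb.ne' ht.ne'] at h
  have h2 := mul_le_mul_of_nonneg_left h ht.le
  have h3 : t * (b / t - 1) = b - t := by field_simp
  rw [h3] at h2
  nlinarith

/-- If every term but the `j`-th is at most `B`, the sum is at most `f j + (n - 1) B`. -/
lemma sum_le_add_card_sub_one_mul {n : ℕ} (f : Fin n → ℝ) (j : Fin n) {A B : ℝ}
    (hA : f j ≤ A) (hB : ∀ i, f i ≤ B) : ∑ i, f i ≤ A + (n - 1 : ℝ) * B := by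
  rw [← Finset.add_sum_erase _ _ (Finset.mem_univ j)]
  have h := Finset.sum_le_card_nsmul (Finset.univ.erase j) f B fun i _ => hB i
  have hn : 1 ≤ n := Nat.succ_le_of_lt (Nat.pos_of_ne_zero fun h0 => by subst h0; exact j.elim0)
  rw [Finset.card_erase_of_mem (Finset.mem_univ j), Finset.card_univ, Fintype.card_fin,
    nsmul_eq_mul, Nat.cast_sub hn, Nat.cast_one] at h
  linarith

/-- Among probability vectors whose entropy is at least that of `(a, b, …, b)`, `b ≤ a`, the
latter maximizes `∑ φ (v i)` with `φ t = (α t + c) log (α t + c)`. -/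
lemma sum_mul_log_le {n : ℕ} (hn : 2 ≤ n) {α c a b : ℝ} (hα : 0 ≤ α) (hc : 0 ≤ c)
    (hαc : 0 < α + c) (hb : 0 ≤ b) (hba : b ≤ a) (hab : a + (n - 1 : ℝ) * b = 1)
    {v : Fin n → ℝ} (hv : probVec v)
    (hent : ∑ i, v i * Real.log (v i) ≤
      a * Real.log a + (n - 1 : ℝ) * (b * Real.log b)) :
    ∑ i, (α * v i + c) * Real.log (α * v i + c) ≤
      (α * a + c) * Real.log (α * a + c) +
        (n - 1 : ℝ) * ((α * b + c) * Real.log (α * b + c)) := by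
  obtain ⟨hv0, hv1⟩ := hv
  have hn' : (2 : ℝ) ≤ n := by exact_mod_cast hn
  have : Nonempty (Fin n) := ⟨⟨0, by omega⟩⟩
  obtain ⟨j, hj⟩ := Finite.exists_max v
  have key : (∃ l m : ℝ, 0 ≤ l ∧
      (∀ t, 0 ≤ t → t ≤ v j →
        (α * t + c) * Real.log (α * t + c) - l * (t * Real.log t) - m * t ≤
          (α * b + c) * Real.log (α * b + c) - l * (b * Real.log b) - m * b) ∧
      (α * v j + c) * Real.log (α * v j + c) - l * (v j * Real.log (v j)) - m * v j ≤
          (α * a + c) * Real.log (α * a + c) - l * (a * Real.log a) - m * a) →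
      ∑ i, (α * v i + c) * Real.log (α * v i + c) ≤
        (α * a + c) * Real.log (α * a + c) +
          (n - 1 : ℝ) * ((α * b + c) * Real.log (α * b + c)) := by
    rintro ⟨l, m, hl, h1, h2⟩
    have hs := sum_le_add_card_sub_one_mul
      (fun i => (α * v i + c) * Real.log (α * v i + c) - l * (v i * Real.log (v i)) - m * v i)
      j h2 (fun i => h1 _ (hv0 i) (hj i))
    rw [Finset.sum_sub_distrib, Finset.sum_sub_distrib, ← Finset.mul_sum, ← Finset.mul_sum,
      hv1] at hs
    have h3 := mul_le_mul_of_nonneg_left hent hl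
    have h4 : m * (a + (n - 1 : ℝ) * b) = m := by rw [hab, mul_one]
    linarith
  rcases hb.eq_or_lt with rfl | hb
  · -- the chord of the convex function `φ` over `[0, 1]`
    have ha : a = 1 := by linarith
    subst ha
    have hvj : v j ≤ 1 := hv1 ▸ Finset.single_le_sum (fun i _ => hv0 i) (Finset.mem_univ j)
    have hchord : ∀ t : ℝ, 0 ≤ t → t ≤ 1 → (α * t + c) * Real.log (α * t + c) ≤
        (1 - t) * (c * Real.log c) + t * ((α + c) * Real.log (α + c)) := by
      intro t h0 h1
      have := Real.convexOn_mul_log.2 (x := c) hc (y := α + c) hαc.le (sub_nonneg.2 h1) h0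
        (by ring)
      simp only [smul_eq_mul] at this
      rwa [show (1 - t) * c + t * (α + c) = α * t + c by ring] at this
    refine key ⟨0, (α + c) * Real.log (α + c) - c * Real.log c, le_rfl, fun t h0 h1 => ?_, ?_⟩
    · have := hchord t h0 (h1.trans hvj)
      simp only [mul_zero, zero_add]
      linarith
    · have := hchord _ (hv0 j) hvj
      simp only [mul_one]
      linarith
  · have hja : v j ≤ a := by
      by_contra! hlt
      have h1 := mul_log_sub_strictMonoOn hb hba (hba.trans hlt.le) hlt
      have hs := sum_le_add_card_sub_one_mul
        (fun i => -(v i * Real.log (v i) - (Real.log b + 1) * v i)) j le_rfl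
        (fun i => neg_le_neg (mul_log_tangent hb (hv0 i)))
      rw [Finset.sum_neg_distrib, Finset.sum_sub_distrib, ← Finset.mul_sum, hv1] at hs
      have h4 : (Real.log b + 1) * (a + (n - 1 : ℝ) * b) = Real.log b + 1 := by
        rw [hab, mul_one]
      simp only at h1
      linarith
    rcases lt_or_ge b (v j) with hbj | hbj
    · exact key (exists_multipliers hα hc hαc hb hbj hja)
    · -- then `v` is the uniform vector and `a = b`
      have hsum := Finset.sum_le_card_nsmul Finset.univ v (v j) fun i _ => hj i
      rw [hv1, Finset.card_univ, Fintype.card_fin, nsmul_eq_mul] at hsum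
      have hnb : (n : ℝ) * v j ≤ n * b := mul_le_mul_of_nonneg_left hbj (by linarith)
      have hab' : a = b := by linarith
      subst hab'
      have hjb : v j = a := by nlinarith
      have hall : ∀ i, v i = a := by
        have : ∑ i, v i = ∑ _i : Fin n, a := by
          rw [hv1, Finset.sum_const, Finset.card_univ, Fintype.card_fin, nsmul_eq_mul]
          linarith
        intro i
        exact (Finset.sum_eq_sum_iff_of_le fun i _ => (hj i).trans hbj).1 this i
          (Finset.mem_univ i)
      simp only [hall, Finset.sum_const, Finset.card_univ, Fintype.card_fin, nsmul_eq_mul]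
      linarith

/-- The mixture of a point mass and the uniform vector has one entry `β + (1 - β) / n`, and all
others equal to `(1 - β) / n`. -/
lemma mixture_eq_ite {n : ℕ} (β : ℝ) (i₀ : Fin n) :
    (β • (fun i => if i = i₀ then (1 : ℝ) else 0) + (1 - β) • fun _ => (n : ℝ)⁻¹) =
      fun i => if i = i₀ then β + (1 - β) / n else (1 - β) / n := by
  funext i
  by_cases h : i = i₀ <;> simp [h, div_eq_mul_inv]

lemma sum_ite_eq_add {n : ℕ} (f : ℝ → ℝ) (a b : ℝ) (i₀ : Fin n) :
    ∑ i, f (if i = i₀ then a else b) = f a + (n - 1 : ℝ) * f b := by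
  have h : ∀ i : Fin n, f (if i = i₀ then a else b) = (if i = i₀ then f a - f b else 0) + f b := by
    intro i
    by_cases h : i = i₀ <;> simp [h]
  simp only [h, Finset.sum_add_distrib, Finset.sum_ite_eq', Finset.mem_univ, if_true,
    Finset.sum_const, Finset.card_univ, Fintype.card_fin, nsmul_eq_mul]
  ring

lemma mixture_entries_mul_log {n : ℕ} (hn : 2 ≤ n) {β : ℝ} (hβ : β ∈ Set.Icc (0 : ℝ) 1) :
    (β + (1 - β) / n) * Real.log (β + (1 - β) / n) +
        (n - 1 : ℝ) * ((1 - β) / n * Real.log ((1 - β) / n)) = gfun n β - Real.log n := by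
  obtain ⟨h0, h1⟩ := hβ
  have hn' : (2 : ℝ) ≤ n := by exact_mod_cast hn
  have hn0 : (n : ℝ) ≠ 0 := by linarith
  have hA : β + (1 - β) / n = (β * n + 1 - β) / n := by field_simp; ring
  have hA0 : β * n + 1 - β ≠ 0 := by nlinarith
  rw [hA, Real.log_div hA0 hn0]
  have hB : (1 - β) / n * Real.log ((1 - β) / n) =
      (1 - β) / n * (Real.log (1 - β) - Real.log n) := by
    rcases h1.eq_or_lt with rfl | h1
    · simp
    · rw [Real.log_div (sub_pos.2 h1).ne' hn0]
  rw [hB, gfun]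
  field_simp
  ring

lemma hammingT_mulVec {n : ℕ} (α : ℝ) {v : Fin n → ℝ} (hv : ∑ i, v i = 1) :
    (hammingT n α).mulVec v = fun i => α * v i + (1 - α) / n := by
  funext i
  rw [hammingT, Matrix.add_mulVec, Matrix.smul_mulVec, Matrix.smul_mulVec, Matrix.one_mulVec]
  simp [Matrix.mulVec, dotProduct, hv]

lemma probVec_mixture {n : ℕ} {β : ℝ} (hβ : β ∈ Set.Icc (0 : ℝ) 1) (i₀ : Fin n) :
    probVec fun i => if i = i₀ then β + (1 - β) / n else (1 - β) / n := by
  obtain ⟨h0, h1⟩ := hβ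
  have hb : 0 ≤ (1 - β) / n := div_nonneg (sub_nonneg.2 h1) n.cast_nonneg
  have hn0 : (n : ℝ) ≠ 0 := by
    rintro h
    rw [Nat.cast_eq_zero] at h
    subst h
    exact i₀.elim0
  refine ⟨fun i => ?_, ?_⟩
  · dsimp only
    split_ifs <;> linarith
  · have h := sum_ite_eq_add (fun x => x) (β + (1 - β) / n) ((1 - β) / n) i₀
    rw [h]
    field_simp
    ring

lemma ent_mixture {n : ℕ} (hn : 2 ≤ n) {β : ℝ} (hβ : β ∈ Set.Icc (0 : ℝ) 1) (i₀ : Fin n) :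
    ent (fun i => if i = i₀ then β + (1 - β) / n else (1 - β) / n) =
      Real.log n - gfun n β := by
  rw [ent, sum_ite_eq_add (fun x => x * Real.log x), mixture_entries_mul_log hn hβ]
  ring

/-- The Hamming channel with parameter `α` maps the mixture with weight `β` to the mixture with
weight `α β`. -/
lemma hammingT_mulVec_mixture {n : ℕ} (α : ℝ) {β : ℝ} (hβ : β ∈ Set.Icc (0 : ℝ) 1)
    (i₀ : Fin n) :
    (hammingT n α).mulVec (fun i => if i = i₀ then β + (1 - β) / n else (1 - β) / n) =
      fun i => if i = i₀ then α * β + (1 - α * β) / n else (1 - α * β) / n := by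
  rw [hammingT_mulVec α (probVec_mixture hβ i₀).2]
  funext i
  by_cases h : i = i₀ <;> simp only [h, if_true, if_false] <;> ring

/-- for the Hamming channel `T_α`, `C ∈ [0, log n]` and `β = gₙ⁻¹(C)`
(i.e. `β ∈ [0,1]` with `gₙ(β) = C`), the vector `v = β·e + (1−β)·uₙ` is feasible
(`H(v) = log n − C`) and attains
`R_{T_α}(uₙ, C) = log n − min{H(T_α v') : v' ∈ Δₙ, H(v') ≥ log n − C}`, whose value is
`gₙ(αβ) = ((1+(n−1)αβ)/n)·log(1+(n−1)αβ) + ((n−1)(1−αβ)/n)·log(1−αβ)`. -/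
theorem stmt11 {n : ℕ} (hn : 2 ≤ n) (α : ℝ) (hα : α ∈ Set.Icc (0 : ℝ) 1)
    (C : ℝ) (hC : C ∈ Set.Icc 0 (Real.log n))
    (β : ℝ) (hβ : β ∈ Set.Icc (0 : ℝ) 1) (hβC : gfun n β = C) (i₀ : Fin n) :
    probVec (β • (fun i => if i = i₀ then (1 : ℝ) else 0) + (1 - β) • fun _ => (n : ℝ)⁻¹) ∧
    ent (β • (fun i => if i = i₀ then (1 : ℝ) else 0) + (1 - β) • fun _ => (n : ℝ)⁻¹) =
      Real.log n - C ∧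
    (∀ v' : Fin n → ℝ, probVec v' → Real.log n - C ≤ ent v' →
      ent ((hammingT n α).mulVec
          (β • (fun i => if i = i₀ then (1 : ℝ) else 0) + (1 - β) • fun _ => (n : ℝ)⁻¹)) ≤
        ent ((hammingT n α).mulVec v')) ∧
    Real.log n -
        ent ((hammingT n α).mulVec
          (β • (fun i => if i = i₀ then (1 : ℝ) else 0) + (1 - β) • fun _ => (n : ℝ)⁻¹)) =
      gfun n (α * β) ∧
    gfun n (α * β) =
      ((1 + (n - 1 : ℝ) * (α * β)) / n) * Real.log (1 + (n - 1 : ℝ) * (α * β)) +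
        ((n - 1 : ℝ) * (1 - α * β) / n) * Real.log (1 - α * β) := by
  simp only [mixture_eq_ite]
  have hn' : (2 : ℝ) ≤ n := by exact_mod_cast hn
  have hαβ : α * β ∈ Set.Icc (0 : ℝ) 1 :=
    ⟨mul_nonneg hα.1 hβ.1, mul_le_one₀ hα.2 hβ.1 hβ.2⟩
  refine ⟨probVec_mixture hβ i₀, by rw [ent_mixture hn hβ, hβC], fun v hv hent => ?_, ?_, ?_⟩
  · have hc : 0 ≤ (1 - α) / n := div_nonneg (sub_nonneg.2 hα.2) n.cast_nonneg
    have hαc : 0 < α + (1 - α) / n := by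
      rcases hα.1.eq_or_lt with h | h
      · rw [← h, zero_add, sub_zero]
        positivity
      · linarith
    have hsum : (β + (1 - β) / n) + (n - 1 : ℝ) * ((1 - β) / n) = 1 := by
      field_simp
      ring
    have key := sum_mul_log_le hn hα.1 hc hαc
      (div_nonneg (sub_nonneg.2 hβ.2) n.cast_nonneg : 0 ≤ (1 - β) / (n : ℝ))
      (le_add_of_nonneg_left hβ.1) hsum hv (by
        rw [mixture_entries_mul_log hn hβ, hβC]
        rw [ent] at hent
        linarith)
    rw [hammingT_mulVec α (probVec_mixture hβ i₀).2, hammingT_mulVec α hv.2, ent, ent]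
    rw [sum_ite_eq_add (fun x => (α * x + (1 - α) / n) * Real.log (α * x + (1 - α) / n))]
    exact neg_le_neg key
  · rw [hammingT_mulVec_mixture α hβ, ent_mixture hn hαβ]
    ring
  · rw [gfun, show α * β * n + 1 - α * β = 1 + (n - 1 : ℝ) * (α * β) by ring]
    ring
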